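/- Let (X,d) be a metric space, w : X → (0,∞), q, p*, v, p ∈ X, 0 < ε ≤ 1/2, and R > 0, and suppose d(q,p*) < R/ε ≤ 2·d(q,p*), d(v,p*) ≤ 2R, d(v,p) ≤ 2R, and w(p) ≥ w(p*). Then d(q,v) < 2R/ε and d(q,p)/w(p) ≤ (1+8ε)·d(q,p*)/w(p*); in particular, p is a (1+8ε)-approximate weighted-distance nearest neighbor of q whenever p* is an exact one. -/

import Mathlib

/-- Correctness of the weighted-distance approximate nearest-neighbor search step
(Lemma 5).  If `d(q,p*) < R/ε ≤ 2 d(q,p*)`, `d(v,p*) ≤ 2R`, `d(v,p) ≤ 2R` and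
`w(p) ≥ w(p*)` with `0 < ε ≤ 1/2`, then `d(q,v) < 2R/ε` and
`d(q,p)/w(p) ≤ (1+8ε)·d(q,p*)/w(p*)`; in particular `p` is a `(1+8ε)`-approximate
weighted-distance nearest neighbor of `q` in any set over which `p*` is exact. -/
theorem stmt7 {X : Type*} [MetricSpace X] (w : X → ℝ) (hw : ∀ x : X, 0 < w x)
    (q pstar v p : X) (ε R : ℝ) (hε0 : 0 < ε) (hε : ε ≤ 1 / 2) (hR : 0 < R)
    (h1 : dist q pstar < R / ε) (h2 : R / ε ≤ 2 * dist q pstar)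
    (h3 : dist v pstar ≤ 2 * R) (h4 : dist v p ≤ 2 * R)
    (h5 : w pstar ≤ w p) :
    dist q v < 2 * R / ε ∧
    dist q p / w p ≤ (1 + 8 * ε) * (dist q pstar / w pstar) ∧
    ∀ S : Set X, pstar ∈ S →
      (∀ s ∈ S, dist q pstar / w pstar ≤ dist q s / w s) →
      ∀ s ∈ S, dist q p / w p ≤ (1 + 8 * ε) * (dist q s / w s) := by
  have hRε : R / ε * ε = R := div_mul_cancel₀ R hε0.ne'
  have hRε0 : 0 < R / ε := div_pos hR hε0
  have hR2 : 2 * R ≤ R / ε := by nlinarith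
  have hRd : R ≤ 2 * ε * dist q pstar := by nlinarith
  have hqv : dist q v ≤ dist q pstar + dist v pstar := dist_triangle_right q v pstar
  have hqp : dist q p ≤ dist q pstar + dist v pstar + dist v p :=
    (dist_triangle q v p).trans (by linarith)
  have hpd : dist q p ≤ (1 + 8 * ε) * dist q pstar := by linarith
  have happrox : dist q p / w p ≤ (1 + 8 * ε) * (dist q pstar / w pstar) := by
    rw [← mul_div_assoc]
    exact div_le_div₀ (by positivity) hpd (hw pstar) h5
  refine ⟨?_, happrox, fun S _ hmin s hs => happrox.trans ?_⟩
  · rw [mul_div_assoc]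
    linarith
  · exact mul_le_mul_of_nonneg_left (hmin s hs) (by positivity)
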